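/- arXiv:1312.1678 — 4 statements merged into one kernel-verified Lean document; each statement's English description precedes it below -/
import Mathlib

section
/- Let c > 0 be a real number and let F be a finite family of n distinct closed discs in the plane ℝ² in general position, such that every subfamily F' ⊆ F has union complexity at most c·|F'|. Let ω ≥ 2 be an integer such that every subfamily of F whose members pairwise intersect has size at most ω. Then the number of unordered pairs {A, B} of distinct members of F with A ∩ B ≠ ∅ is at most ((c·e/2 + 1)·ω − 1)·n. -/
open scoped Classical

/-- The probability, when each element of `F` is kept independently with probability `p`, that
all of `S` is kept and all of `K` is discarded. -/
lemma sum_powerset_weight_of_subset_of_disjoint {α : Type*} (p : ℝ) {F S K : Finset α}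
    (hS : S ⊆ F) (hK : K ⊆ F) (hSK : Disjoint S K) :
    ∑ R ∈ F.powerset, (if S ⊆ R ∧ Disjoint R K then p ^ R.card * (1 - p) ^ (F \ R).card else 0) =
      p ^ S.card * (1 - p) ^ K.card := by
  have h := Finset.prod_add (fun i => if i ∈ K then 0 else p)
    (fun i => if i ∈ S then 0 else 1 - p) F
  have hl : ∏ i ∈ F, ((if i ∈ K then 0 else p) + (if i ∈ S then 0 else 1 - p)) =
      p ^ S.card * (1 - p) ^ K.card := by
    have : ∀ i ∈ F, ((if i ∈ K then 0 else p) + (if i ∈ S then 0 else 1 - p)) =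
        (if i ∈ S then p else 1) * (if i ∈ K then 1 - p else 1) := by
      intro i _
      by_cases h1 : i ∈ S
      · have h2 : i ∉ K := Finset.disjoint_left.mp hSK h1
        simp [h1, h2]
      · by_cases h2 : i ∈ K <;> simp [h1, h2]
    rw [Finset.prod_congr rfl this, Finset.prod_mul_distrib, Finset.prod_ite_mem,
      Finset.prod_ite_mem, Finset.inter_eq_right.mpr hS, Finset.inter_eq_right.mpr hK]
    simp
  rw [← hl, h]
  refine Finset.sum_congr rfl fun R hR => ?_
  split_ifs with hc
  · have hkeep : ∀ i ∈ R, (if i ∈ K then 0 else p) = p := fun i hi =>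
      if_neg (Finset.disjoint_left.mp hc.2 hi)
    have hdrop : ∀ i ∈ F \ R, (if i ∈ S then 0 else 1 - p) = 1 - p := fun i hi =>
      if_neg fun hiS => (Finset.mem_sdiff.mp hi).2 (hc.1 hiS)
    rw [Finset.prod_congr rfl hkeep, Finset.prod_congr rfl hdrop, Finset.prod_const,
      Finset.prod_const]
  · rw [not_and_or] at hc
    rcases hc with hc | hc
    · obtain ⟨i, hiS, hiR⟩ := Finset.not_subset.mp hc
      rw [Finset.prod_eq_zero (i := i) (s := F \ R) (by simp [hS hiS, hiR]) (by simp [hiS]),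
        mul_zero]
    · obtain ⟨i, hiR, hiK⟩ := Finset.not_disjoint_iff.mp hc
      rw [Finset.prod_eq_zero (i := i) (s := R) hiR (by simp [hiK]), zero_mul]

/-- The expected size of a random subset. -/
lemma sum_powerset_weight_mul_card {α : Type*} (p : ℝ) (F : Finset α) :
    ∑ R ∈ F.powerset, p ^ R.card * (1 - p) ^ (F \ R).card * R.card = p * F.card := by
  have h : ∀ R ∈ F.powerset, p ^ R.card * (1 - p) ^ (F \ R).card * (R.card : ℝ) =
      ∑ d ∈ F, if {d} ⊆ R ∧ Disjoint R ∅ then p ^ R.card * (1 - p) ^ (F \ R).card else 0 := by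
    intro R hR
    simp only [Finset.singleton_subset_iff, Finset.disjoint_empty_right, and_true]
    rw [Finset.sum_ite_mem, Finset.inter_eq_right.mpr (Finset.mem_powerset.mp hR)]
    simp [mul_comm]
  rw [Finset.sum_congr rfl h, Finset.sum_comm, Finset.sum_congr rfl fun d hd =>
    sum_powerset_weight_of_subset_of_disjoint p (S := {d}) (K := ∅) (by simpa using hd)
      (by simp) (by simp)]
  simp [mul_comm]

/-- The Clarkson–Shor bound: if every `x ∈ V` has a pair `S x` of defining elements and a disjoint
set `K x` of at most `m` conflicting elements, and every `R ⊆ F` has at most `c * |R|` points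
`x` with `S x ⊆ R` and no conflict in `R`, then `V` is small. -/
lemma card_mul_le_of_forall_subset {α β : Type*} {c p : ℝ} (hp : 0 < p) (hp1 : p ≤ 1)
    {m : ℕ} (F : Finset α) (V : Finset β) (S K : β → Finset α)
    (hS : ∀ x ∈ V, S x ⊆ F) (hS2 : ∀ x ∈ V, (S x).card = 2) (hK : ∀ x ∈ V, K x ⊆ F)
    (hKm : ∀ x ∈ V, (K x).card ≤ m) (hSK : ∀ x ∈ V, Disjoint (S x) (K x))
    (h : ∀ R ⊆ F, ∀ U ⊆ V, (∀ x ∈ U, S x ⊆ R ∧ Disjoint R (K x)) →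
      (U.card : ℝ) ≤ c * R.card) :
    V.card * (p * (1 - p) ^ m) ≤ c * F.card := by
  have hq : 0 ≤ 1 - p := by linarith
  have h1 : V.card * (p ^ 2 * (1 - p) ^ m) ≤ ∑ x ∈ V, ∑ R ∈ F.powerset,
      (if S x ⊆ R ∧ Disjoint R (K x) then p ^ R.card * (1 - p) ^ (F \ R).card else 0) := by
    rw [← nsmul_eq_mul]
    refine Finset.card_nsmul_le_sum _ _ _ fun x hx => ?_
    rw [sum_powerset_weight_of_subset_of_disjoint p (hS x hx) (hK x hx) (hSK x hx), hS2 x hx]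
    exact mul_le_mul_of_nonneg_left
      (pow_le_pow_of_le_one hq (by linarith) (hKm x hx)) (by positivity)
  have h2 : ∑ x ∈ V, ∑ R ∈ F.powerset,
      (if S x ⊆ R ∧ Disjoint R (K x) then p ^ R.card * (1 - p) ^ (F \ R).card else 0) ≤
      ∑ R ∈ F.powerset, c * (p ^ R.card * (1 - p) ^ (F \ R).card * R.card) := by
    rw [Finset.sum_comm]
    refine Finset.sum_le_sum fun R hR => ?_
    rw [← Finset.sum_filter, Finset.sum_const, nsmul_eq_mul]
    have := mul_le_mul_of_nonneg_right (h R (Finset.mem_powerset.mp hR)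
      {x ∈ V | S x ⊆ R ∧ Disjoint R (K x)} (Finset.filter_subset _ _)
      fun x hx => (Finset.mem_filter.mp hx).2)
      (show 0 ≤ p ^ R.card * (1 - p) ^ (F \ R).card by positivity)
    linarith
  rw [← Finset.mul_sum, sum_powerset_weight_mul_card] at h2
  have h3 := h1.trans h2
  refine le_of_mul_le_mul_left ?_ hp
  linarith

lemma exp_neg_one_le_one_sub_inv_pow {n : ℕ} (hn : 2 ≤ n) :
    Real.exp (-1) ≤ (1 - (n : ℝ)⁻¹) ^ (n - 2) := by
  obtain ⟨k, rfl⟩ := Nat.exists_eq_add_of_le' hn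
  have hk : (0 : ℝ) < k + 1 := by positivity
  have h1 : Real.exp (-(1 / (k + 1 : ℝ))) ≤ 1 - ((k + 2 : ℕ) : ℝ)⁻¹ := by
    have h2 : 1 - ((k + 2 : ℕ) : ℝ)⁻¹ = (1 / (k + 1 : ℝ) + 1)⁻¹ := by
      push_cast
      field_simp
      ring
    rw [h2, Real.exp_neg]
    exact inv_anti₀ (by positivity) (Real.add_one_le_exp _)
  calc Real.exp (-1) ≤ Real.exp (k * -(1 / (k + 1 : ℝ))) := by
        refine Real.exp_le_exp.mpr ?_
        have : (k : ℝ) * (1 / (k + 1)) ≤ 1 := by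
          rw [mul_one_div, div_le_one hk]
          linarith
        linarith
    _ = Real.exp (-(1 / (k + 1 : ℝ))) ^ k := Real.exp_nat_mul _ _
    _ ≤ _ := by
        simpa using pow_le_pow_left₀ (Real.exp_nonneg _) h1 k

lemma le_of_mul_inv_mul_pow_le {n : ℕ} (hn : 2 ≤ n) {a b : ℝ} (ha : 0 ≤ a)
    (h : a * ((n : ℝ)⁻¹ * (1 - (n : ℝ)⁻¹) ^ (n - 2)) ≤ b) : a ≤ b * (Real.exp 1 * n) := by
  have hn0 : (0 : ℝ) < n := by positivity
  have hexp : a * ((n : ℝ)⁻¹ * Real.exp (-1)) ≤ b := by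
    refine le_trans ?_ h
    gcongr
    exact exp_neg_one_le_one_sub_inv_pow hn
  have hcancel : Real.exp (-1) * Real.exp 1 = 1 := by simp [← Real.exp_add]
  calc a = a * ((n : ℝ)⁻¹ * Real.exp (-1)) * (Real.exp 1 * n) := by
        field_simp
        linear_combination -a * hcancel
    _ ≤ _ := by gcongr

section Balls

open Metric

variable {E : Type*} [NormedAddCommGroup E] [InnerProductSpace ℝ E]

/-- At a common point of two spheres that are not externally tangent there, some direction leaves
both balls at once. -/
lemma exists_forall_lt_dist_add_smul {a b x y : E} {r s : ℝ} (hr : 0 < r) (hs : 0 < s)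
    (hxy : x ≠ y) (hxa : dist x a = r) (hxb : dist x b = s) (hya : dist y a = r)
    (hyb : dist y b = s) :
    ∃ v : E, ∀ t : ℝ, 0 < t → r < dist (x + t • v) a ∧ s < dist (x + t • v) b := by
  have key : 0 < r * s + inner ℝ (x - a) (x - b) := by
    have hle := neg_le_of_abs_le (abs_real_inner_le_norm (x - a) (x - b))
    rw [dist_eq_norm] at hxa hxb hya hyb
    rw [hxa, hxb] at hle
    by_contra! hcon
    have heq : inner ℝ (x - a) (x - b) = -(r * s) := by linarith
    have hz : s • (x - a) + r • (x - b) = 0 := by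
      have : ‖s • (x - a) + r • (x - b)‖ ^ 2 = 0 := by
        rw [norm_add_sq_real, norm_smul, norm_smul, inner_smul_left, inner_smul_right, heq, hxa,
          hxb, Real.norm_of_nonneg hr.le, Real.norm_of_nonneg hs.le]
        simp
        ring
      simpa using this
    have h1 : ‖(y - x) + (x - a)‖ ^ 2 = r ^ 2 := by rw [sub_add_sub_cancel, hya]
    have h2 : ‖(y - x) + (x - b)‖ ^ 2 = s ^ 2 := by rw [sub_add_sub_cancel, hyb]
    rw [norm_add_sq_real, hxa] at h1
    rw [norm_add_sq_real, hxb] at h2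
    have h3 : s * inner ℝ (y - x) (x - a) + r * inner ℝ (y - x) (x - b) = 0 := by
      rw [← real_inner_smul_right, ← real_inner_smul_right, ← inner_add_right, hz,
        inner_zero_right]
    have h4 : (r + s) * ‖y - x‖ ^ 2 = 0 := by linear_combination s * h1 + r * h2 - 2 * h3
    have h5 : ‖y - x‖ = 0 := by
      rcases mul_eq_zero.mp h4 with h | h
      · linarith
      · simpa using h
    exact hxy (sub_eq_zero.mp (norm_eq_zero.mp h5)).symm
  have leave : ∀ (w : E) (ρ : ℝ) (v : E), ‖w‖ = ρ → 0 < inner ℝ w v → ∀ t : ℝ, 0 < t →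
      ρ < ‖w + t • v‖ := by
    intro w ρ v hw hwv t ht
    refine lt_of_pow_lt_pow_left₀ 2 (norm_nonneg _) ?_
    rw [norm_add_sq_real, inner_smul_right, hw]
    have := mul_pos ht hwv
    nlinarith [sq_nonneg ‖t • v‖]
  rw [dist_eq_norm] at hxa hxb
  refine ⟨s • (x - a) + r • (x - b), fun t ht => ?_⟩
  rw [dist_eq_norm, dist_eq_norm, add_sub_right_comm, add_sub_right_comm]
  constructor
  · refine leave _ _ _ hxa ?_ t ht
    rw [inner_add_right, inner_smul_right, inner_smul_right, real_inner_self_eq_norm_sq, hxa]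
    nlinarith
  · refine leave _ _ _ hxb ?_ t ht
    rw [inner_add_right, inner_smul_right, inner_smul_right, real_inner_self_eq_norm_sq, hxb,
      real_inner_comm]
    nlinarith

lemma mem_frontier_iUnion_closedBall (R : Finset (E × ℝ)) {A B : E × ℝ} (hA : A ∈ R)
    (hrA : 0 < A.2) (hrB : 0 < B.2) {x y : E} (hxy : x ≠ y)
    (hx : x ∈ sphere A.1 A.2 ∩ sphere B.1 B.2) (hy : y ∈ sphere A.1 A.2 ∩ sphere B.1 B.2)
    (hR : ∀ d ∈ R, d ≠ A → d ≠ B → x ∉ closedBall d.1 d.2) :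
    x ∈ frontier (⋃ d ∈ (R : Set (E × ℝ)), closedBall d.1 d.2) := by
  obtain ⟨v, hv⟩ := exists_forall_lt_dist_add_smul hrA hrB hxy hx.1 hx.2 hy.1 hy.2
  rw [frontier_eq_closure_inter_closure]
  refine ⟨subset_closure (Set.mem_biUnion hA (sphere_subset_closedBall hx.1)), ?_⟩
  have hlim : Filter.Tendsto (fun t : ℝ => x + t • v) (nhdsWithin 0 (Set.Ioi 0)) (nhds x) := by
    have : Continuous fun t : ℝ => x + t • v := by fun_prop
    simpa using (this.tendsto 0).mono_left nhdsWithin_le_nhds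
  refine mem_closure_of_tendsto hlim ?_
  have hfar : ∀ᶠ t in nhdsWithin (0 : ℝ) (Set.Ioi 0), ∀ d ∈ R,
      d ≠ A → d ≠ B → x + t • v ∉ closedBall d.1 d.2 := by
    rw [Filter.eventually_all_finset]
    intro d hd
    by_cases h1 : d = A
    · simp [h1]
    by_cases h2 : d = B
    · simp [h2]
    filter_upwards [hlim (isClosed_closedBall.isOpen_compl.mem_nhds (hR d hd h1 h2))] with t ht
    exact fun _ _ => ht
  filter_upwards [hfar, self_mem_nhdsWithin] with t ht htpos
  simp only [Set.mem_compl_iff, Set.mem_iUnion, not_exists]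
  intro d hd hmem
  obtain ⟨hvA, hvB⟩ := hv t htpos
  by_cases h1 : d = A
  · subst h1
    exact hvA.not_ge hmem
  by_cases h2 : d = B
  · subst h2
    exact hvB.not_ge hmem
  exact ht d hd h1 h2 hmem

/-- If two balls meet but their bounding spheres do not, then one contains the centre of the
other. -/
lemma mem_closedBall_or_mem_closedBall_of_disjoint_sphere (hE : 1 < Module.rank ℝ E) {a b : E}
    {r s : ℝ} (hr : 0 ≤ r) (hab : (closedBall a r ∩ closedBall b s).Nonempty)
    (h : Disjoint (sphere a r) (sphere b s)) : a ∈ closedBall b s ∨ b ∈ closedBall a r := by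
  by_contra! hcon
  simp only [mem_closedBall, not_le] at hcon
  obtain ⟨hsd, hrd⟩ := hcon
  obtain ⟨z, hza, hzb⟩ := hab
  have hd : dist b a ≤ r + s := by
    linarith [dist_triangle_left b a z, mem_closedBall.mp hza, mem_closedBall.mp hzb]
  have hpos : 0 < dist b a := hr.trans_lt hrd
  rw [dist_comm a b] at hsd
  have hnorm : ‖b - a‖ = dist b a := (dist_eq_norm b a).symm
  have hmem : ∀ e : ℝ, |e| = 1 → a + (e * (r / dist b a)) • (b - a) ∈ sphere a r := by
    intro e he
    rw [mem_sphere, dist_eq_norm, add_sub_cancel_left, norm_smul, hnorm, norm_mul,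
      Real.norm_eq_abs, he, Real.norm_of_nonneg (by positivity)]
    field_simp
  have hdist : ∀ e : ℝ, dist (a + (e * (r / dist b a)) • (b - a)) b = |dist b a - e * r| := by
    intro e
    have : a + (e * (r / dist b a)) • (b - a) - b = (e * (r / dist b a) - 1) • (b - a) := by
      module
    rw [dist_eq_norm, this, norm_smul, hnorm, Real.norm_eq_abs, ← abs_of_pos hpos, ← abs_mul,
      abs_of_pos hpos, abs_sub_comm]
    congr 1
    field_simp
  obtain ⟨y, hya, hyb⟩ := (isPreconnected_sphere hE a r).intermediate_value
    (hmem 1 (by simp)) (hmem (-1) (by simp))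
    (f := fun y => dist y b) (by fun_prop) (show s ∈ Set.Icc _ _ by
      simp only [hdist]
      rw [abs_of_nonneg (by linarith), abs_of_nonneg (by linarith)]
      constructor <;> linarith)
  exact Set.disjoint_left.mp h hya hyb

end Balls

/-- In a family whose intersecting subfamilies have at most `ω` members, few pairs consist of a
ball and another ball containing its centre. -/
lemma card_pairs_center_mem_le {X : Type*} [PseudoMetricSpace X] (F : Finset (X × ℝ))
    (hrad : ∀ d ∈ F, 0 < d.2) (ω : ℕ)
    (hclique : ∀ G ⊆ F, (∀ d ∈ G, ∀ d' ∈ G,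
      (Metric.closedBall d.1 d.2 ∩ Metric.closedBall d'.1 d'.2).Nonempty) → G.card ≤ ω)
    (P : Finset (Finset (X × ℝ)))
    (hP : ∀ s ∈ P, ∃ A ∈ F, ∃ B ∈ F, A ≠ B ∧ (∀ d, d ∈ s ↔ d = A ∨ d = B) ∧ A.1 ∈ Metric.closedBall B.1 B.2) :
    P.card ≤ F.card * (ω - 1) := by
  let T : X × ℝ → Finset (X × ℝ) := fun A => {B ∈ F | A ≠ B ∧ A.1 ∈ Metric.closedBall B.1 B.2}
  have hsub : P ⊆ F.biUnion fun A => (T A).image fun B => {A, B} := by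
    intro s hs
    obtain ⟨A, hA, B, hB, hne, hAB, hmem⟩ := hP s hs
    simp only [Finset.mem_biUnion, Finset.mem_image]
    exact ⟨A, hA, B, by simp [T, hB, hne, Metric.mem_closedBall.mp hmem], by ext; simp [hAB]⟩
  refine (Finset.card_le_card hsub).trans (Finset.card_biUnion_le_card_mul _ _ _ fun A hA => ?_)
  refine Finset.card_image_le.trans ?_
  have hA' : A ∉ T A := by simp [T]
  have hmem : ∀ d ∈ insert A (T A), d ∈ F ∧ A.1 ∈ Metric.closedBall d.1 d.2 := by
    intro d hd
    rcases Finset.mem_insert.mp hd with rfl | hd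
    · exact ⟨hA, Metric.mem_closedBall_self (hrad _ hA).le⟩
    · have := Finset.mem_filter.mp hd
      exact ⟨this.1, this.2.2⟩
  have := hclique (insert A (T A)) (fun d hd => (hmem d hd).1)
    fun d hd d' hd' => ⟨A.1, (hmem d hd).2, (hmem d' hd').2⟩
  rw [Finset.card_insert_of_notMem hA'] at this
  omega

/-- The crossing pairs of a family of balls in general position with linear union complexity. -/
lemma card_crossing_pairs_le {E : Type*} [NormedAddCommGroup E] [InnerProductSpace ℝ E] {c : ℝ}
    (F : Finset (E × ℝ)) (hrad : ∀ d ∈ F, 0 < d.2)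
    (hgen3 : ∀ x : E, ({d ∈ F | x ∈ Metric.sphere d.1 d.2}).card ≤ 2)
    (huc : ∀ F' ⊆ F,
      {x : E | x ∈ frontier (⋃ d ∈ (F' : Set (E × ℝ)), Metric.closedBall d.1 d.2) ∧
        2 ≤ ({d ∈ F' | x ∈ Metric.sphere d.1 d.2}).card}.Finite ∧
      ({x : E | x ∈ frontier (⋃ d ∈ (F' : Set (E × ℝ)), Metric.closedBall d.1 d.2) ∧
        2 ≤ ({d ∈ F' | x ∈ Metric.sphere d.1 d.2}).card}.ncard : ℝ) ≤ c * F'.card)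
    (ω : ℕ) (hω : 2 ≤ ω)
    (hclique : ∀ G ⊆ F, (∀ d ∈ G, ∀ d' ∈ G,
      (Metric.closedBall d.1 d.2 ∩ Metric.closedBall d'.1 d'.2).Nonempty) → G.card ≤ ω)
    (P : Finset (Finset (E × ℝ)))
    (hP : ∀ s ∈ P, ∃ A ∈ F, ∃ B ∈ F, A ≠ B ∧ (∀ d, d ∈ s ↔ d = A ∨ d = B) ∧
      (Metric.sphere A.1 A.2 ∩ Metric.sphere B.1 B.2).encard = 2) :
    (P.card : ℝ) ≤ c * Real.exp 1 / 2 * ω * F.card := by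
  let S : E → Finset (E × ℝ) := fun x => {d ∈ F | x ∈ Metric.sphere d.1 d.2}
  let K : E → Finset (E × ℝ) := fun x => {d ∈ F | x ∈ Metric.ball d.1 d.2}
  have hpts : ∀ s ∈ P, ∃ x y, x ≠ y ∧ S x = s ∧ S y = s := by
    intro s hs
    obtain ⟨A, hA, B, hB, hne, hAB, hcard⟩ := hP s hs
    obtain rfl : s = {A, B} := by ext; simp [hAB]
    obtain ⟨x, y, hxy, hset⟩ := Set.encard_eq_two.mp hcard
    have hS : ∀ z ∈ Metric.sphere A.1 A.2 ∩ Metric.sphere B.1 B.2, S z = {A, B} := by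
      intro z hz
      symm
      refine Finset.eq_of_subset_of_card_le ?_ ((hgen3 z).trans_eq (Finset.card_pair hne).symm)
      intro d hd
      rcases Finset.mem_insert.mp hd with rfl | hd
      · exact Finset.mem_filter.mpr ⟨hA, hz.1⟩
      · rw [Finset.mem_singleton.mp hd]
        exact Finset.mem_filter.mpr ⟨hB, hz.2⟩
    exact ⟨x, y, hxy, hS x (by simp [hset]), hS y (by simp [hset])⟩
  choose! f g hfg hf hg using hpts
  let V : Finset E := P.biUnion fun s => {f s, g s}
  have hV : ∀ x ∈ V, S x ∈ P ∧ ∃ y, x ≠ y ∧ S y = S x := by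
    intro x hx
    obtain ⟨s, hs, hxs⟩ := Finset.mem_biUnion.mp hx
    rcases Finset.mem_insert.mp hxs with rfl | hxs
    · rw [hf s hs]
      exact ⟨hs, g s, hfg s hs, hg s hs⟩
    · rw [Finset.mem_singleton.mp hxs, hg s hs]
      exact ⟨hs, f s, (hfg s hs).symm, hf s hs⟩
  have hVcard : V.card = P.card * 2 := by
    refine (Finset.card_biUnion ?_).trans (Finset.sum_const_nat fun s hs =>
      Finset.card_pair (hfg s hs))
    intro s hs t ht hst
    refine Finset.disjoint_left.mpr fun x hxs hxt => hst ?_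
    have h : ∀ u ∈ P, x ∈ ({f u, g u} : Finset E) → S x = u := by
      intro u hu hx
      rcases Finset.mem_insert.mp hx with rfl | hx
      · exact hf u hu
      · rw [Finset.mem_singleton.mp hx, hg u hu]
    exact (h s hs hxs).symm.trans (h t ht hxt)
  have hS2 : ∀ x ∈ V, (S x).card = 2 := by
    intro x hx
    obtain ⟨A, -, B, -, hne, hs, -⟩ := hP _ (hV x hx).1
    rw [show S x = {A, B} by ext; simp [hs], Finset.card_pair hne]
  have hSK : ∀ x ∈ V, Disjoint (S x) (K x) := by
    intro x _
    refine Finset.disjoint_left.mpr fun d hd hd' => ?_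
    exact (Metric.mem_ball.mp (Finset.mem_filter.mp hd').2).ne (Finset.mem_filter.mp hd).2
  have hKm : ∀ x ∈ V, (K x).card ≤ ω - 2 := by
    intro x hx
    have hmem : ∀ d ∈ S x ∪ K x, d ∈ F ∧ x ∈ Metric.closedBall d.1 d.2 := by
      intro d hd
      rcases Finset.mem_union.mp hd with hd | hd
      · have := Finset.mem_filter.mp hd
        exact ⟨this.1, Metric.sphere_subset_closedBall this.2⟩
      · have := Finset.mem_filter.mp hd
        exact ⟨this.1, Metric.ball_subset_closedBall this.2⟩
    have := hclique (S x ∪ K x) (fun d hd => (hmem d hd).1)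
      fun d hd d' hd' => ⟨x, (hmem d hd).2, (hmem d' hd').2⟩
    rw [Finset.card_union_of_disjoint (hSK x hx), hS2 x hx] at this
    omega
  have hR : ∀ R ⊆ F, ∀ U ⊆ V, (∀ x ∈ U, S x ⊆ R ∧ Disjoint R (K x)) →
      (U.card : ℝ) ≤ c * R.card := by
    intro R hRF U hUV hU
    refine le_trans ?_ (huc R hRF).2
    rw [← Set.ncard_coe_finset]
    refine Nat.cast_le.mpr (Set.ncard_le_ncard ?_ (huc R hRF).1)
    intro x hx
    have hxV := hUV hx
    obtain ⟨hSR, hRK⟩ := hU x hx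
    obtain ⟨hxP, y, hxy, hy⟩ := hV x hxV
    obtain ⟨A, hA, B, hB, hne, hs, -⟩ := hP _ hxP
    have hAS : A ∈ S x := by simp [hs]
    have hBS : B ∈ S x := by simp [hs]
    have hsphere : ∀ {z d}, d ∈ S z → z ∈ Metric.sphere d.1 d.2 :=
      fun h => (Finset.mem_filter.mp h).2
    refine ⟨mem_frontier_iUnion_closedBall R (hSR hAS) (hrad A hA) (hrad B hB) hxy
      ⟨hsphere hAS, hsphere hBS⟩ ⟨hsphere (hy ▸ hAS), hsphere (hy ▸ hBS)⟩ ?_, ?_⟩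
    · intro d hd hdA hdB hmem
      rcases (Metric.mem_closedBall.mp hmem).lt_or_eq with h | h
      · exact Finset.disjoint_left.mp hRK hd (Finset.mem_filter.mpr ⟨hRF hd, h⟩)
      · have : d ∈ S x := Finset.mem_filter.mpr ⟨hRF hd, h⟩
        exact ((hs d).mp this).elim hdA hdB
    · rw [← hS2 x hxV]
      exact Finset.card_le_card fun d hd => Finset.mem_filter.mpr ⟨hSR hd, hsphere hd⟩
  have hω1 : (ω : ℝ)⁻¹ ≤ 1 := inv_le_one_of_one_le₀ (by exact_mod_cast (by omega : 1 ≤ ω))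
  have hmain := card_mul_le_of_forall_subset (inv_pos.mpr (by positivity)) hω1 F V S K
    (fun x _ => Finset.filter_subset _ _) hS2 (fun x _ => Finset.filter_subset _ _) hKm hSK hR
  rw [hVcard] at hmain
  push_cast at hmain
  linarith [le_of_mul_inv_mul_pow_le hω (by positivity) hmain]

/-- **Theorem 1 of the paper, instantiated for closed discs.**
A disc is given by a pair `d = (center, radius)` in `EuclideanSpace ℝ (Fin 2) × ℝ`,
with the disc itself being `Metric.closedBall d.1 d.2` and its boundary circle
`Metric.sphere d.1 d.2`.  If every subfamily `F' ⊆ F` has union complexity (the number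
of points of the frontier of `⋃ F'` lying on at least two boundary circles of members
of `F'`) at most `c·|F'|`, and every pairwise-intersecting subfamily has size at most
`ω`, then the number of intersecting pairs is at most `((c·e/2 + 1)·ω − 1)·n`. -/
theorem stmt_0 (c : ℝ) (hc : 0 < c)
    (F : Finset (EuclideanSpace ℝ (Fin 2) × ℝ))
    (hrad : ∀ d ∈ F, 0 < d.2)
    (hgen2 : ∀ d ∈ F, ∀ d' ∈ F, d ≠ d' →
      (Metric.sphere d.1 d.2 ∩ Metric.sphere d'.1 d'.2).encard = 0 ∨
      (Metric.sphere d.1 d.2 ∩ Metric.sphere d'.1 d'.2).encard = 2)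
    (hgen3 : ∀ x : EuclideanSpace ℝ (Fin 2),
      ({d ∈ F | x ∈ Metric.sphere d.1 d.2}).card ≤ 2)
    (huc : ∀ F' ⊆ F,
      {x : EuclideanSpace ℝ (Fin 2) |
        x ∈ frontier (⋃ d ∈ (F' : Set (EuclideanSpace ℝ (Fin 2) × ℝ)),
          Metric.closedBall d.1 d.2) ∧
        2 ≤ ({d ∈ F' | x ∈ Metric.sphere d.1 d.2}).card}.Finite ∧
      ({x : EuclideanSpace ℝ (Fin 2) |
        x ∈ frontier (⋃ d ∈ (F' : Set (EuclideanSpace ℝ (Fin 2) × ℝ)),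
          Metric.closedBall d.1 d.2) ∧
        2 ≤ ({d ∈ F' | x ∈ Metric.sphere d.1 d.2}).card}.ncard : ℝ) ≤ c * F'.card)
    (ω : ℕ) (hω : 2 ≤ ω)
    (hclique : ∀ G ⊆ F, (∀ d ∈ G, ∀ d' ∈ G,
      (Metric.closedBall d.1 d.2 ∩ Metric.closedBall d'.1 d'.2).Nonempty) → G.card ≤ ω) :
    (((F.powersetCard 2).filter (fun s => ∃ A ∈ s, ∃ B ∈ s, A ≠ B ∧
        (Metric.closedBall A.1 A.2 ∩ Metric.closedBall B.1 B.2).Nonempty)).card : ℝ) ≤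
      ((c * Real.exp 1 / 2 + 1) * ω - 1) * F.card := by
  set Q := (F.powersetCard 2).filter (fun s => ∃ A ∈ s, ∃ B ∈ s, A ≠ B ∧
    (Metric.closedBall A.1 A.2 ∩ Metric.closedBall B.1 B.2).Nonempty) with hQ
  let crosses : Finset (EuclideanSpace ℝ (Fin 2) × ℝ) → Prop := fun s =>
    ∃ A ∈ F, ∃ B ∈ F, A ≠ B ∧ (∀ d, d ∈ s ↔ d = A ∨ d = B) ∧
      (Metric.sphere A.1 A.2 ∩ Metric.sphere B.1 B.2).encard = 2
  have hcross : ((Q.filter crosses).card : ℝ) ≤ c * Real.exp 1 / 2 * ω * F.card :=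
    card_crossing_pairs_le F hrad hgen3 huc ω hω hclique _ fun s hs => by
      simpa only [crosses] using (Finset.mem_filter.mp hs).2
  have hnest : (Q.filter fun s => ¬ crosses s).card ≤ F.card * (ω - 1) := by
    refine card_pairs_center_mem_le F hrad ω hclique _ fun s hs => ?_
    obtain ⟨hsQ, hsc⟩ := Finset.mem_filter.mp hs
    obtain ⟨hs2, A, hAs, B, hBs, hne, hAB⟩ := Finset.mem_filter.mp hsQ
    obtain ⟨hsF, hcard⟩ := Finset.mem_powersetCard.mp hs2
    have hs : ∀ d, d ∈ s ↔ d = A ∨ d = B := by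
      suffices {A, B} = s by simp [← this]
      refine Finset.eq_of_subset_of_card_le ?_ (by rw [hcard, Finset.card_pair hne])
      simp [Finset.insert_subset_iff, hAs, hBs]
    have hdisj : Disjoint (Metric.sphere A.1 A.2) (Metric.sphere B.1 B.2) := by
      rcases hgen2 A (hsF hAs) B (hsF hBs) hne with h | h
      · exact Set.disjoint_iff_inter_eq_empty.mpr (Set.encard_eq_zero.mp h)
      · exact absurd ⟨A, hsF hAs, B, hsF hBs, hne, hs, h⟩ hsc
    have hrank : 1 < Module.rank ℝ (EuclideanSpace ℝ (Fin 2)) := by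
      rw [← Module.finrank_eq_rank]
      simp
    rcases mem_closedBall_or_mem_closedBall_of_disjoint_sphere hrank (hrad A (hsF hAs)).le hAB hdisj with h | h
    · exact ⟨A, hsF hAs, B, hsF hBs, hne, hs, h⟩
    · exact ⟨B, hsF hBs, A, hsF hAs, hne.symm, fun d => (hs d).trans or_comm, h⟩
  have hsum := Finset.card_filter_add_card_filter_not (s := Q) crosses
  have hnest' : ((Q.filter fun s => ¬ crosses s).card : ℝ) ≤ F.card * (ω - 1) := by
    have h : ((ω - 1 : ℕ) : ℝ) = ω - 1 := by push_cast [show 1 ≤ ω by omega]; ring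
    rw [← h]
    exact_mod_cast hnest
  rw [← hsum]
  push_cast
  linarith
end

section
/- Let F be a finite family of n distinct closed discs in ℝ², all containing a common point O in their interiors, such that any two distinct boundary circles intersect in 0 or 2 points and no point of ℝ² lies on three boundary circles. Then for every integer k ≥ 1, the number of points x ∈ ℝ² that lie on the boundary circles of two distinct discs of F and belong to at most k discs of F is at most 2(k−1)·n. -/
open scoped Classical

local notation "ℝ²" => EuclideanSpace ℝ (Fin 2)

/-- The unit vector of the plane in direction `θ`. -/
noncomputable def direction (θ : ℝ) : EuclideanSpace ℝ (Fin 2) := !₂[Real.cos θ, Real.sin θ]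

/-- The angle in `(-π, π]` of the plane vector `x - O`. -/
noncomputable def angleFrom (O x : ℝ²) : ℝ := Complex.arg ⟨x 0 - O 0, x 1 - O 1⟩

/-- The distance from `O`, in direction `θ`, to the boundary of the disc `d` around `O`. -/
noncomputable def radialDist (O : ℝ²) (d : ℝ² × ℝ) (θ : ℝ) : ℝ :=
  inner ℝ (direction θ) (d.1 - O) +
    √(inner ℝ (direction θ) (d.1 - O) ^ 2 + (d.2 ^ 2 - ‖d.1 - O‖ ^ 2))

lemma norm_direction (θ : ℝ) : ‖direction θ‖ = 1 := by
  simp [direction, EuclideanSpace.norm_eq]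

lemma continuous_direction : Continuous direction := by
  unfold direction
  fun_prop

lemma continuous_radialDist (O : ℝ²) (d : ℝ² × ℝ) : Continuous (radialDist O d) := by
  have := continuous_direction
  unfold radialDist
  fun_prop

lemma angleFrom_mem_Ioc (O x : ℝ²) : angleFrom O x ∈ Set.Ioc (-Real.pi) Real.pi :=
  Complex.arg_mem_Ioc _

lemma exists_eq_add_smul_direction (O x : ℝ²) :
    ∃ t : ℝ, 0 ≤ t ∧ x = O + t • direction (angleFrom O x) := by
  refine ⟨‖(⟨x 0 - O 0, x 1 - O 1⟩ : ℂ)‖, norm_nonneg _, ?_⟩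
  ext i
  fin_cases i
  · simp [direction, angleFrom, Complex.norm_mul_cos_arg]
  · simp [direction, angleFrom, Complex.norm_mul_sin_arg]

lemma angleFrom_add_smul_direction (O : ℝ²) {t θ : ℝ} (ht : 0 < t)
    (hθ : θ ∈ Set.Ioc (-Real.pi) Real.pi) : angleFrom O (O + t • direction θ) = θ := by
  have h := Complex.arg_mul_cos_add_sin_mul_I ht hθ
  convert h using 1
  unfold angleFrom
  congr 1
  apply Complex.ext <;> simp [direction, ← Complex.ofReal_cos, ← Complex.ofReal_sin]

lemma dist_add_smul_direction_sq (O c : ℝ²) (t θ : ℝ) :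
    dist (O + t • direction θ) c ^ 2 =
      t ^ 2 - 2 * t * inner ℝ (direction θ) (c - O) + ‖c - O‖ ^ 2 := by
  rw [dist_eq_norm, show O + t • direction θ - c = t • direction θ - (c - O) by abel,
    norm_sub_sq_real, norm_smul, norm_direction, inner_smul_left]
  simp
  ring

section Radial

variable {O : EuclideanSpace ℝ (Fin 2)} {d : EuclideanSpace ℝ (Fin 2) × ℝ}

lemma dist_sq_sub_sq_eq (hd : O ∈ Metric.ball d.1 d.2) (t θ : ℝ) :
    ∃ s, 0 < s ∧ 0 < radialDist O d θ ∧ dist (O + t • direction θ) d.1 ^ 2 - d.2 ^ 2 =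
      (t - radialDist O d θ) * (t + s) := by
  have hp : 0 < d.2 ^ 2 - ‖d.1 - O‖ ^ 2 := by
    rw [Metric.mem_ball, dist_comm, dist_eq_norm] at hd
    nlinarith [norm_nonneg (d.1 - O)]
  set q : ℝ := inner ℝ (direction θ) (d.1 - O) with hq
  have hlt : |q| < √(q ^ 2 + (d.2 ^ 2 - ‖d.1 - O‖ ^ 2)) := by
    rw [← Real.sqrt_sq_eq_abs]
    exact Real.sqrt_lt_sqrt (sq_nonneg q) (by linarith)
  have hs := Real.sq_sqrt (show 0 ≤ q ^ 2 + (d.2 ^ 2 - ‖d.1 - O‖ ^ 2) by positivity)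
  obtain ⟨h₁, h₂⟩ := abs_lt.1 hlt
  refine ⟨√(q ^ 2 + (d.2 ^ 2 - ‖d.1 - O‖ ^ 2)) - q, by linarith, ?_, ?_⟩
  · rw [radialDist, ← hq]
    linarith
  · rw [dist_add_smul_direction_sq, radialDist, ← hq]
    linear_combination hs

lemma radialDist_pos (hd : O ∈ Metric.ball d.1 d.2) (θ : ℝ) : 0 < radialDist O d θ :=
  let ⟨_, _, h, _⟩ := dist_sq_sub_sq_eq hd 0 θ
  h

lemma add_smul_direction_mem_sphere (hd : O ∈ Metric.ball d.1 d.2) {t : ℝ} (ht : 0 ≤ t) (θ : ℝ) :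
    O + t • direction θ ∈ Metric.sphere d.1 d.2 ↔ t = radialDist O d θ := by
  obtain ⟨s, hs, -, h⟩ := dist_sq_sub_sq_eq hd t θ
  rw [Metric.mem_sphere, ← sq_eq_sq₀ dist_nonneg (Metric.pos_of_mem_ball hd).le, ← sub_eq_zero, h,
    mul_eq_zero, or_iff_left (by positivity), sub_eq_zero]

lemma add_smul_direction_mem_closedBall (hd : O ∈ Metric.ball d.1 d.2) {t : ℝ} (ht : 0 ≤ t)
    (θ : ℝ) : O + t • direction θ ∈ Metric.closedBall d.1 d.2 ↔ t ≤ radialDist O d θ := by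
  obtain ⟨s, hs, -, h⟩ := dist_sq_sub_sq_eq hd t θ
  rw [Metric.mem_closedBall, ← sq_le_sq₀ dist_nonneg (Metric.pos_of_mem_ball hd).le, ← sub_nonpos,
    h, ← sub_nonpos (a := t)]
  have hts : 0 < t + s := by positivity
  exact ⟨fun h ↦ nonpos_of_mul_nonpos_left h hts, fun h ↦ mul_nonpos_of_nonpos_of_nonneg h hts.le⟩

lemma eq_add_radialDist_smul_direction (hd : O ∈ Metric.ball d.1 d.2) {x : ℝ²}
    (hx : x ∈ Metric.sphere d.1 d.2) :
    x = O + radialDist O d (angleFrom O x) • direction (angleFrom O x) := by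
  obtain ⟨t, ht, h⟩ := exists_eq_add_smul_direction O x
  rw [h, add_smul_direction_mem_sphere hd ht] at hx
  rwa [← hx]

lemma angleFrom_injOn_sphere (hd : O ∈ Metric.ball d.1 d.2) :
    Set.InjOn (angleFrom O) (Metric.sphere d.1 d.2) := by
  intro x hx y hy h
  rw [eq_add_radialDist_smul_direction hd hx, eq_add_radialDist_smul_direction hd hy, h]

end Radial

section Pair

variable {O : EuclideanSpace ℝ (Fin 2)} {a b : EuclideanSpace ℝ (Fin 2) × ℝ}

lemma mem_closedBall_of_radialDist_le (ha : O ∈ Metric.ball a.1 a.2)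
    (hb : O ∈ Metric.ball b.1 b.2) {y : ℝ²} (hy : y ∈ Metric.sphere b.1 b.2)
    (h : radialDist O b (angleFrom O y) ≤ radialDist O a (angleFrom O y)) :
    y ∈ Metric.closedBall a.1 a.2 := by
  rw [eq_add_radialDist_smul_direction hb hy]
  exact (add_smul_direction_mem_closedBall ha (radialDist_pos hb _).le _).2 h

/-- Over an interval of directions containing no common point of two circles around `O`,
one of the two circles lies inside the other one. -/
lemma sphere_subset_closedBall_or (ha : O ∈ Metric.ball a.1 a.2) (hb : O ∈ Metric.ball b.1 b.2)
    {J : Set ℝ} (hJ : IsPreconnected J) (hJπ : J ⊆ Set.Ioc (-Real.pi) Real.pi)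
    (h : ∀ y ∈ Metric.sphere a.1 a.2 ∩ Metric.sphere b.1 b.2, angleFrom O y ∉ J) :
    (∀ y ∈ Metric.sphere b.1 b.2, angleFrom O y ∈ J → y ∈ Metric.closedBall a.1 a.2) ∨
      ∀ y ∈ Metric.sphere a.1 a.2, angleFrom O y ∈ J → y ∈ Metric.closedBall b.1 b.2 := by
  by_contra! hne
  obtain ⟨⟨y, hy, hyJ, hya⟩, z, hz, hzJ, hzb⟩ := hne
  have hy' := mt (mem_closedBall_of_radialDist_le ha hb hy) hya
  have hz' := mt (mem_closedBall_of_radialDist_le hb ha hz) hzb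
  obtain ⟨θ, hθ, heq⟩ := hJ.intermediate_value₂ hyJ hzJ (continuous_radialDist O a).continuousOn
    (continuous_radialDist O b).continuousOn (not_le.1 hy').le (not_le.1 hz').le
  have hpos := radialDist_pos ha θ
  refine h (O + radialDist O a θ • direction θ)
    ⟨(add_smul_direction_mem_sphere ha hpos.le θ).2 rfl,
      (add_smul_direction_mem_sphere hb hpos.le θ).2 heq⟩ ?_
  rwa [angleFrom_add_smul_direction O hpos (hJπ hθ)]

end Pair

/-- The point `x` is the first point in the order given by `ψ` at which the circle `∂b` meets some
circle `∂a` of the family, and `∂b` runs inside the disc `a` up to `x`. -/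
def IsFirstExit (F : Finset (ℝ² × ℝ)) (ψ : ℝ² → ℝ) (b : ℝ² × ℝ) (x : ℝ²) : Prop :=
  ∃ a ∈ F, a ≠ b ∧ x ∈ Metric.sphere a.1 a.2 ∧ x ∈ Metric.sphere b.1 b.2 ∧
    (∀ y ∈ Metric.sphere b.1 b.2, ψ y ≤ ψ x → y ∈ Metric.closedBall a.1 a.2) ∧
    ∀ y ∈ Metric.sphere a.1 a.2 ∩ Metric.sphere b.1 b.2, ψ x ≤ ψ y

/-- A circle `∂b` of the family carries at most `k - 1` first exits of depth at most `k`. -/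
lemma card_le_of_isFirstExit {F : Finset (ℝ² × ℝ)} {ψ : ℝ² → ℝ} {b : ℝ² × ℝ} (hb : b ∈ F)
    (hψ : Set.InjOn ψ (Metric.sphere b.1 b.2)) {k : ℕ} {T : Finset ℝ²}
    (hT : ∀ x ∈ T, IsFirstExit F ψ b x)
    (hk : ∀ x ∈ T, ({d ∈ F | x ∈ Metric.closedBall d.1 d.2}).card ≤ k) :
    T.card ≤ k - 1 := by
  rcases T.eq_empty_or_nonempty with rfl | hne
  · simp
  obtain ⟨x₀, hx₀, hmin⟩ := T.exists_min_image ψ hne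
  choose! a haF hab hxa hxb hin hfirst using hT
  have hinj : Set.InjOn a T := fun x hx y hy h ↦ hψ (hxb x hx) (hxb y hy) <|
    (hfirst x hx y ⟨h ▸ hxa y hy, hxb y hy⟩).antisymm
      (hfirst y hy x ⟨h ▸ hxa x hx, hxb x hx⟩)
  have hmaps : Set.MapsTo a T
      (({d ∈ F | x₀ ∈ Metric.closedBall d.1 d.2} : Finset (ℝ² × ℝ)).erase b) := by
    intro x hx
    simp only [Finset.coe_erase, Finset.coe_filter, Set.mem_sdiff, Set.mem_ofPred_eq,
      Set.mem_singleton_iff]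
    exact ⟨⟨haF x hx, hin x hx x₀ (hxb x₀ hx₀) (hmin x hx)⟩, hab x hx⟩
  refine (Finset.card_le_card_of_injOn a hmaps hinj).trans ?_
  have hbx₀ : b ∈ ({d ∈ F | x₀ ∈ Metric.closedBall d.1 d.2} : Finset (ℝ² × ℝ)) :=
    Finset.mem_filter.2 ⟨hb, Metric.sphere_subset_closedBall (hxb x₀ hx₀)⟩
  rw [Finset.card_erase_of_mem hbx₀]
  exact Nat.sub_le_sub_right (hk x₀ hx₀) 1

/-- A common point of two circles around `O` is a first exit for one of them, if no other common
point precedes it in the order given by `ψ`. -/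
lemma exists_isFirstExit {F : Finset (ℝ² × ℝ)} {O : ℝ²} {ψ : ℝ² → ℝ} {a b : ℝ² × ℝ}
    (haF : a ∈ F) (hbF : b ∈ F) (hab : a ≠ b)
    (ha : O ∈ Metric.ball a.1 a.2) (hb : O ∈ Metric.ball b.1 b.2)
    (hψa : Set.InjOn ψ (Metric.sphere a.1 a.2)) (hψb : Set.InjOn ψ (Metric.sphere b.1 b.2))
    {x : ℝ²} (hxa : x ∈ Metric.sphere a.1 a.2) (hxb : x ∈ Metric.sphere b.1 b.2)
    {J : Set ℝ} (hJ : IsPreconnected J) (hJπ : J ⊆ Set.Ioc (-Real.pi) Real.pi)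
    (hψJ : ∀ y, angleFrom O y ∈ J ↔ ψ y < ψ x)
    (hfirst : ∀ y ∈ Metric.sphere a.1 a.2 ∩ Metric.sphere b.1 b.2, ψ x ≤ ψ y) :
    ∃ c ∈ F, IsFirstExit F ψ c x := by
  have extend : ∀ {c d : ℝ² × ℝ}, Set.InjOn ψ (Metric.sphere d.1 d.2) →
      x ∈ Metric.sphere c.1 c.2 → x ∈ Metric.sphere d.1 d.2 →
      (∀ y ∈ Metric.sphere d.1 d.2, angleFrom O y ∈ J → y ∈ Metric.closedBall c.1 c.2) →
      ∀ y ∈ Metric.sphere d.1 d.2, ψ y ≤ ψ x → y ∈ Metric.closedBall c.1 c.2 := by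
    intro c d hψ hxc hxd h y hy hle
    rcases hle.lt_or_eq with hlt | heq
    · exact h y hy ((hψJ y).2 hlt)
    · exact hψ hy hxd heq ▸ Metric.sphere_subset_closedBall hxc
  rcases sphere_subset_closedBall_or ha hb hJ hJπ
    fun y hy hyJ ↦ ((hψJ y).1 hyJ).not_ge (hfirst y hy) with h | h
  · exact ⟨b, hbF, a, haF, hab, hxa, hxb, extend hψb hxa hxb h, hfirst⟩
  · exact ⟨a, haF, b, hbF, hab.symm, hxb, hxa, extend hψa hxb hxa h,
      fun y hy ↦ hfirst y hy.symm⟩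

/-- In a set with at most two elements, none precedes a given one in the order given by `φ`, or none
follows it. -/
lemma forall_le_or_forall_ge_of_encard_le_two {α : Type*} {S : Set α} (hS : S.encard ≤ 2)
    (φ : α → ℝ) {x : α} (hx : x ∈ S) : (∀ y ∈ S, φ x ≤ φ y) ∨ ∀ y ∈ S, φ y ≤ φ x := by
  by_contra! h
  obtain ⟨⟨y, hy, hyx⟩, z, hz, hxz⟩ := h
  have h3 : ({y, x, z} : Set α).encard = 3 := Set.encard_eq_three.2
    ⟨y, x, z, fun h ↦ hyx.ne (h ▸ rfl), fun h ↦ (hyx.trans hxz).ne (h ▸ rfl),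
      fun h ↦ hxz.ne (h ▸ rfl), rfl⟩
  have hle := (Set.encard_le_encard (show {y, x, z} ⊆ S by
    rintro w (rfl | rfl | rfl) <;> assumption)).trans hS
  rw [h3] at hle
  exact absurd hle (by decide)


open scoped Classical

/-- **Theorem 3 of the paper, instantiated for round closed discs.**
A disc is given by a pair `d = (center, radius)` with positive radius; the disc itself
is `Metric.closedBall d.1 d.2` and its boundary circle is `Metric.sphere d.1 d.2`.
If all discs of `F` contain a common point `O` in their interiors, any two distinct
boundary circles meet in `0` or `2` points, and no point lies on three boundary
circles, then the number of points lying on at least two boundary circles and belonging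
to at most `k` discs of `F` is at most `2(k−1)·n`. -/
theorem stmt_4 (F : Finset (EuclideanSpace ℝ (Fin 2) × ℝ))
    (hrad : ∀ d ∈ F, 0 < d.2)
    (O : EuclideanSpace ℝ (Fin 2))
    (hO : ∀ d ∈ F, O ∈ interior (Metric.closedBall d.1 d.2))
    (hgen2 : ∀ d ∈ F, ∀ d' ∈ F, d ≠ d' →
      (Metric.sphere d.1 d.2 ∩ Metric.sphere d'.1 d'.2).encard = 0 ∨
      (Metric.sphere d.1 d.2 ∩ Metric.sphere d'.1 d'.2).encard = 2)
    (hgen3 : ∀ x : EuclideanSpace ℝ (Fin 2),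
      ({d ∈ F | x ∈ Metric.sphere d.1 d.2}).card ≤ 2)
    (k : ℕ) (hk : 1 ≤ k) :
    {x : EuclideanSpace ℝ (Fin 2) |
      2 ≤ ({d ∈ F | x ∈ Metric.sphere d.1 d.2}).card ∧
      ({d ∈ F | x ∈ Metric.closedBall d.1 d.2}).card ≤ k}.encard ≤
      (2 * (k - 1) * F.card : ℕ) := by
  have hball : ∀ d ∈ F, O ∈ Metric.ball d.1 d.2 := fun d hd ↦ by
    simpa only [interior_closedBall d.1 (hrad d hd).ne'] using hO d hd
  let ψ : Bool → EuclideanSpace ℝ (Fin 2) → ℝ :=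
    fun ε x ↦ if ε then -angleFrom O x else angleFrom O x
  have hψ : ∀ ε, ∀ d ∈ F, Set.InjOn (ψ ε) (Metric.sphere d.1 d.2) := by
    intro ε d hd x hx y hy h
    refine angleFrom_injOn_sphere (hball d hd) hx hy ?_
    cases ε <;> simpa [ψ] using h
  have hexit : ∀ x : EuclideanSpace ℝ (Fin 2),
      2 ≤ ({d ∈ F | x ∈ Metric.sphere d.1 d.2}).card →
      ∃ p : (EuclideanSpace ℝ (Fin 2) × ℝ) × Bool, p.1 ∈ F ∧ IsFirstExit F (ψ p.2) p.1 x := by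
    intro x hx
    obtain ⟨a, ha, b, hb, hab⟩ := Finset.one_lt_card.1 hx
    obtain ⟨haF, hxa⟩ := Finset.mem_filter.1 ha
    obtain ⟨hbF, hxb⟩ := Finset.mem_filter.1 hb
    have hcard : (Metric.sphere a.1 a.2 ∩ Metric.sphere b.1 b.2).encard ≤ 2 := by
      rcases hgen2 a haF b hbF hab with h | h <;> simp [h]
    have hmem := angleFrom_mem_Ioc O
    rcases forall_le_or_forall_ge_of_encard_le_two hcard (angleFrom O) ⟨hxa, hxb⟩ with h | h
    · obtain ⟨c, hc, hcx⟩ := exists_isFirstExit (ψ := ψ false)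
        (J := Set.Ioo (-Real.pi) (angleFrom O x))
        haF hbF hab (hball a haF) (hball b hbF) (hψ _ a haF) (hψ _ b hbF) hxa hxb
        isPreconnected_Ioo (fun θ hθ ↦ ⟨hθ.1, hθ.2.le.trans (hmem x).2⟩)
        (fun y ↦ by simp [ψ, (hmem y).1]) (by simpa [ψ] using h)
      exact ⟨(c, false), hc, hcx⟩
    · obtain ⟨c, hc, hcx⟩ := exists_isFirstExit (ψ := ψ true)
        (J := Set.Ioc (angleFrom O x) Real.pi)
        haF hbF hab (hball a haF) (hball b hbF) (hψ _ a haF) (hψ _ b hbF) hxa hxb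
        isPreconnected_Ioc (fun θ hθ ↦ ⟨(hmem x).1.trans hθ.1, hθ.2⟩)
        (fun y ↦ by simp [ψ, (hmem y).2]) (by simpa [ψ] using h)
      exact ⟨(c, true), hc, hcx⟩
  choose! p hpF hp using hexit
  by_contra! hlt
  obtain ⟨T, hTV, hTcard⟩ := Set.exists_subset_encard_eq (Order.add_one_le_of_lt hlt)
  have hfin : T.Finite := Set.finite_of_encard_eq_coe (k := 2 * (k - 1) * F.card + 1) (by
    rw [hTcard]; rfl)
  lift T to Finset (EuclideanSpace ℝ (Fin 2)) using hfin
  have hbound := Finset.card_le_mul_card_image_of_maps_to (s := T) (f := p)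
    (t := F ×ˢ Finset.univ) (fun x hx ↦ by simpa using hpF x (hTV hx).1) (k - 1)
    fun q hq ↦ card_le_of_isFirstExit (Finset.mem_product.1 hq).1
      (hψ q.2 q.1 (Finset.mem_product.1 hq).1)
      (fun x hx ↦ (Finset.mem_filter.1 hx).2 ▸ hp x (hTV (Finset.mem_filter.1 hx).1).1)
      (fun x hx ↦ (hTV (Finset.mem_filter.1 hx).1).2)
  rw [Set.encard_coe_eq_coe_finsetCard] at hTcard
  have hTcard' : T.card = 2 * (k - 1) * F.card + 1 := by exact_mod_cast hTcard
  rw [Finset.card_product, Finset.card_univ, Fintype.card_bool] at hbound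
  linarith [mul_comm (k - 1) (F.card * 2), mul_assoc F.card 2 (k - 1),
    mul_comm F.card (2 * (k - 1))]
end

section
/- Let F be a finite set of size n, let ω ≥ 2 be an integer and c > 0 a real number. Let Z be a finite set equipped with maps a, b : Z → F and D : Z → Finset F such that for every z ∈ Z: a z ≠ b z, a z ∉ D z, b z ∉ D z, and |D z| ≤ ω − 2. Suppose that for every subset F' ⊆ F, the number of z ∈ Z with a z ∈ F', b z ∈ F', and D z ∩ F' = ∅ is at most c·|F'|. Then for every real p with 0 < p ≤ 1, |Z|·p²·(1−p)^(ω−2) ≤ c·p·n. -/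
open scoped Classical

/-- A random subset of `F`, containing each element independently with probability `p`, contains
`A` and avoids `B` with probability `p ^ #A * (1 - p) ^ #B`. -/
theorem sum_powerset_bernoulli_subset_disjoint {α : Type*} (F A B : Finset α) (hA : A ⊆ F)
    (hB : B ⊆ F) (hAB : Disjoint A B) (p : ℝ) :
    ∑ S ∈ F.powerset, (if A ⊆ S ∧ Disjoint B S then
      p ^ S.card * (1 - p) ^ (F \ S).card else 0) = p ^ A.card * (1 - p) ^ B.card := by
  have key := Finset.prod_add (fun i => if i ∈ B then 0 else p)
    (fun i => if i ∈ A then 0 else 1 - p) F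
  have hprod : ∏ i ∈ F, ((if i ∈ B then 0 else p) + (if i ∈ A then 0 else 1 - p)) =
      p ^ A.card * (1 - p) ^ B.card := by
    have hfactor : ∀ i ∈ F, ((if i ∈ B then 0 else p) + (if i ∈ A then 0 else 1 - p)) =
        (if i ∈ A then p else 1) * (if i ∈ B then 1 - p else 1) := by
      intro i _
      by_cases hiA : i ∈ A
      · simp [hiA, Finset.disjoint_left.mp hAB hiA]
      · by_cases hiB : i ∈ B <;> simp [hiA, hiB]
    rw [Finset.prod_congr rfl hfactor, Finset.prod_mul_distrib, Finset.prod_ite_mem,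
      Finset.prod_ite_mem, Finset.inter_eq_right.mpr hA, Finset.inter_eq_right.mpr hB,
      Finset.prod_const, Finset.prod_const]
  rw [← hprod, key]
  refine Finset.sum_congr rfl fun S _ => ?_
  split_ifs with h
  · obtain ⟨hAS, hBS⟩ := h
    rw [Finset.prod_congr rfl fun i hi => if_neg (Finset.disjoint_right.mp hBS hi),
      Finset.prod_congr rfl fun i hi => if_neg fun hiA => (Finset.mem_sdiff.mp hi).2 (hAS hiA),
      Finset.prod_const, Finset.prod_const]
  · rw [not_and_or] at h
    symm
    rcases h with h | h
    · obtain ⟨i, hiA, hiS⟩ := Finset.not_subset.mp h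
      exact mul_eq_zero_of_right _
        (Finset.prod_eq_zero (Finset.mem_sdiff.mpr ⟨hA hiA, hiS⟩) (if_pos hiA))
    · obtain ⟨i, hiB, hiS⟩ := Finset.not_disjoint_iff.mp h
      refine mul_eq_zero_of_left ?_ _
      exact Finset.prod_eq_zero hiS (if_pos hiB)

/-- The expected size of a random subset of `F`, containing each element independently with
probability `p`, is `p * #F`. -/
theorem sum_powerset_bernoulli_mul_card {α : Type*} (F : Finset α) (p : ℝ) :
    ∑ S ∈ F.powerset, p ^ S.card * (1 - p) ^ (F \ S).card * S.card = p * F.card := by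
  have hsingle : ∀ i ∈ F, ∑ S ∈ F.powerset, (if i ∈ S then
      p ^ S.card * (1 - p) ^ (F \ S).card else 0) = p := fun i hi => by
    simpa using sum_powerset_bernoulli_subset_disjoint F {i} ∅
      (Finset.singleton_subset_iff.mpr hi) (Finset.empty_subset F)
      (Finset.disjoint_empty_right _) p
  calc _ = ∑ S ∈ F.powerset, ∑ i ∈ F, (if i ∈ S then
        p ^ S.card * (1 - p) ^ (F \ S).card else 0) := by
        refine Finset.sum_congr rfl fun S hS => ?_
        rw [Finset.sum_ite_mem, Finset.inter_eq_right.mpr (Finset.mem_powerset.mp hS),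
          Finset.sum_const, nsmul_eq_mul, mul_comm]
    _ = p * F.card := by
        rw [Finset.sum_comm, Finset.sum_congr rfl hsingle, Finset.sum_const, nsmul_eq_mul,
          mul_comm]

/-- **The intermediate expectation inequality** in the probabilistic argument of
Theorem 1: with each element of `F` picked independently with probability `p`, each
`z ∈ Z` survives (both defining elements picked, no covering element picked) with
probability at least `p²(1−p)^(ω−2)`, while the expected number of surviving `z` is at
most `c·p·n`; hence `|Z|·p²·(1−p)^(ω−2) ≤ c·p·n` for all `0 < p ≤ 1`. -/
theorem stmt_8 {α β : Type*} (F : Finset α) (ω : ℕ) (hω : 2 ≤ ω) (c : ℝ) (hc : 0 < c)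
    (Z : Finset β) (a b : β → α) (D : β → Finset α)
    (ha : ∀ z ∈ Z, a z ∈ F) (hb : ∀ z ∈ Z, b z ∈ F) (hDF : ∀ z ∈ Z, D z ⊆ F)
    (hab : ∀ z ∈ Z, a z ≠ b z)
    (haD : ∀ z ∈ Z, a z ∉ D z) (hbD : ∀ z ∈ Z, b z ∉ D z)
    (hDcard : ∀ z ∈ Z, (D z).card ≤ ω - 2)
    (hsample : ∀ F' ⊆ F,
      (({z ∈ Z | a z ∈ F' ∧ b z ∈ F' ∧ D z ∩ F' = ∅}).card : ℝ) ≤ c * F'.card) :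
    ∀ p : ℝ, 0 < p → p ≤ 1 →
      (Z.card : ℝ) * p ^ 2 * (1 - p) ^ (ω - 2) ≤ c * p * F.card := by
  intro p hp hp1
  have hq : 0 ≤ 1 - p := sub_nonneg.mpr hp1
  have hsurvive : ∀ z ∈ Z, p ^ 2 * (1 - p) ^ (ω - 2) ≤
      ∑ S ∈ F.powerset, (if a z ∈ S ∧ b z ∈ S ∧ D z ∩ S = ∅ then
        p ^ S.card * (1 - p) ^ (F \ S).card else 0) := by
    intro z hz
    have h := sum_powerset_bernoulli_subset_disjoint F {a z, b z} (D z)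
      (by simp [Finset.insert_subset_iff, ha z hz, hb z hz]) (hDF z hz)
      (by simp [haD z hz, hbD z hz]) p
    rw [Finset.card_pair (hab z hz)] at h
    simp only [Finset.insert_subset_iff, Finset.singleton_subset_iff, and_assoc,
      Finset.disjoint_iff_inter_eq_empty] at h
    rw [h]
    exact mul_le_mul_of_nonneg_left
      (pow_le_pow_of_le_one hq (by linarith) (hDcard z hz)) (by positivity)
  calc (Z.card : ℝ) * p ^ 2 * (1 - p) ^ (ω - 2)
      = ∑ z ∈ Z, p ^ 2 * (1 - p) ^ (ω - 2) := by
        rw [Finset.sum_const, nsmul_eq_mul, mul_assoc]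
    _ ≤ _ := Finset.sum_le_sum hsurvive
    _ = ∑ S ∈ F.powerset, p ^ S.card * (1 - p) ^ (F \ S).card *
        ({z ∈ Z | a z ∈ S ∧ b z ∈ S ∧ D z ∩ S = ∅}).card := by
        rw [Finset.sum_comm]
        refine Finset.sum_congr rfl fun S _ => ?_
        rw [← Finset.sum_filter, Finset.sum_const, nsmul_eq_mul, mul_comm]
    _ ≤ ∑ S ∈ F.powerset, p ^ S.card * (1 - p) ^ (F \ S).card * (c * S.card) :=
        Finset.sum_le_sum fun S hS => mul_le_mul_of_nonneg_left
          (hsample S (Finset.mem_powerset.mp hS)) (by positivity)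
    _ = c * p * F.card := by
        rw [mul_assoc, ← sum_powerset_bernoulli_mul_card, Finset.mul_sum]
        exact Finset.sum_congr rfl fun S _ => by ring
end

section
/- Let k ≥ 2 and n ≥ k be integers, and let y₁ < y₂ < ... < y_{k−1} be real numbers with 0 < y_j < 1/4 for all j. Define the family F of n functions ℝ → ℝ consisting of the constant functions ℓ_j(x) = y_j for j = 1, ..., k−1 and the functions p_i(x) = (x − i)² for i = 1, ..., n−k+1. Then the number of pairs (x, {f, g}), where f ≠ g are members of F with f x = g x and the number of h ∈ F \ {f, g} with h x < f x is at most k − 2, is at least 2(k−1)·(n−k+1). -/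
open scoped Classical

/-- A parabola `x ↦ (x - a)²` is not a constant function. -/
lemma const_ne_sub_sq (c a : ℝ) : (fun _ : ℝ => c) ≠ fun x => (x - a) ^ 2 := by
  intro h
  have h0 := congrFun h a
  have h1 := congrFun h (a + 1)
  norm_num at h0 h1
  linarith

/-- The parabola `x ↦ (x - a)²` determines its apex. -/
lemma sub_sq_injective : Function.Injective fun (a x : ℝ) => (x - a) ^ 2 := by
  intro a b h
  have h0 := congrFun h a
  simp only [sub_self, ne_eq, OfNat.ofNat_ne_zero, not_false_eq_true, zero_pow] at h0
  exact sub_eq_zero.mp (pow_eq_zero_iff two_ne_zero |>.mp h0.symm)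

/-- Two natural numbers both at distance less than `1/2` from a shifted real are equal. -/
lemma nat_eq_of_sub_sq_lt {a b : ℕ} {x : ℝ} (ha : (x - (a + 1)) ^ 2 < 1 / 4)
    (hb : (x - (b + 1)) ^ 2 < 1 / 4) : a = b := by
  have ha' : |x - (a + 1)| < 1 / 2 := abs_lt_of_sq_lt_sq (by linarith) (by norm_num)
  have hb' : |x - (b + 1)| < 1 / 2 := abs_lt_of_sq_lt_sq (by linarith) (by norm_num)
  rw [abs_lt] at ha' hb'
  have h1 : (a : ℝ) < b + 1 := by linarith
  have h2 : (b : ℝ) < a + 1 := by linarith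
  norm_cast at h1 h2
  omega

/-- A constant function and a parabola are determined by the pair they form. -/
lemma pair_const_sub_sq_inj {c d a b : ℝ}
    (h : ({fun _ => c, fun x => (x - a) ^ 2} : Finset (ℝ → ℝ)) =
      {fun _ => d, fun x => (x - b) ^ 2}) : c = d ∧ a = b := by
  have hc : (fun _ : ℝ => c) ∈ ({fun _ => d, fun x => (x - b) ^ 2} : Finset (ℝ → ℝ)) :=
    h ▸ Finset.mem_insert_self _ _
  have ha : (fun x : ℝ => (x - a) ^ 2) ∈
      ({fun _ => d, fun x => (x - b) ^ 2} : Finset (ℝ → ℝ)) :=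
    h ▸ Finset.mem_insert_of_mem (Finset.mem_singleton_self _)
  rw [Finset.mem_insert, Finset.mem_singleton] at hc ha
  exact ⟨congrFun (hc.resolve_right (const_ne_sub_sq c b)) 0,
    sub_sq_injective (ha.resolve_left (const_ne_sub_sq d a).symm)⟩

/-- The `x`-coordinate of the right (`b = true`) or left (`b = false`) intersection point of the
constant function `c` with the parabola of apex `a`. -/
noncomputable def crossing (c a : ℝ) (b : Bool) : ℝ :=
  a + cond b (√c) (-√c)

lemma crossing_sub_sq {c : ℝ} (hc : 0 ≤ c) (a : ℝ) (b : Bool) : (crossing c a b - a) ^ 2 = c := by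
  cases b <;> simp [crossing, Real.sq_sqrt hc]

lemma crossing_injective {c : ℝ} (hc : 0 < c) (a : ℝ) : Function.Injective (crossing c a) := by
  have := Real.sqrt_pos.mpr hc
  rintro (_ | _) (_ | _) h <;> simp only [crossing, cond_true, cond_false] at h ⊢ <;> linarith

/-- **The counting claim in the Remark after Theorem 4.**  For the family `F`
consisting of the `k − 1` constant functions `ℓ_j(x) = y_j` (with `0 < y_j < 1/4`
increasing) and the `n − k + 1` parabolas `p_i(x) = (x − i)²`, `i = 1, …, n − k + 1`,
the number of intersection points `(x, {f, g})` of two distinct members of `F` lying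
strictly above at most `k − 2` other members of `F` is at least `2(k−1)(n−k+1)`;
hence the bound of Theorem 4 is attained up to an additive constant. -/
theorem stmt_13 (k n : ℕ) (hk : 2 ≤ k) (hkn : k ≤ n)
    (y : Fin (k - 1) → ℝ) (hmono : StrictMono y)
    (hy0 : ∀ j, 0 < y j) (hy4 : ∀ j, y j < 1 / 4) :
    let Φ : Fin (k - 1) ⊕ Fin (n - k + 1) → ℝ → ℝ :=
      Sum.elim (fun j _ => y j) (fun i x => (x - ((i : ℕ) + 1)) ^ 2)
    let F : Finset (ℝ → ℝ) := Finset.univ.image Φ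
    (2 * (k - 1) * (n - k + 1) : ℕ) ≤
      {p : ℝ × Finset (ℝ → ℝ) | p.2 ⊆ F ∧ p.2.card = 2 ∧
        (∀ f ∈ p.2, ∀ g ∈ p.2, f p.1 = g p.1) ∧
        (∀ f ∈ p.2, (({h ∈ F | h ∉ p.2 ∧ h p.1 < f p.1}).card : ℤ) ≤ (k : ℤ) - 2)}.encard := by
  intro Φ F
  let P : (Fin (k - 1) × Fin (n - k + 1)) × Bool → ℝ × Finset (ℝ → ℝ) := fun t =>
    (crossing (y t.1.1) ((t.1.2 : ℕ) + 1) t.2, {Φ (.inl t.1.1), Φ (.inr t.1.2)})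
  have hP : Function.Injective P := by
    rintro ⟨⟨j, i⟩, b⟩ ⟨⟨j', i'⟩, b'⟩ h
    obtain ⟨hx, hpair⟩ := Prod.ext_iff.mp h
    obtain ⟨hj, hi⟩ := pair_const_sub_sq_inj hpair
    obtain rfl := hmono.injective hj
    obtain rfl : i = i' := Fin.ext (by exact_mod_cast add_right_cancel hi)
    obtain rfl := crossing_injective (hy0 j) _ hx
    rfl
  have hcard : ((2 * (k - 1) * (n - k + 1) : ℕ) : ℕ∞) = (Set.range P).encard := by
    rw [← Set.image_univ, hP.encard_image, Set.encard_univ, ENat.card_eq_coe_fintype_card]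
    simp only [Fintype.card_prod, Fintype.card_fin, Fintype.card_bool]
    congr 1
    ring
  rw [hcard]
  refine Set.encard_le_encard ?_
  rintro _ ⟨⟨⟨j, i⟩, b⟩, rfl⟩
  set x := crossing (y j) ((i : ℕ) + 1) b
  have hxi : (x - ((i : ℕ) + 1)) ^ 2 = y j := crossing_sub_sq (hy0 j).le _ b
  have hval : ∀ f ∈ ({Φ (.inl j), Φ (.inr i)} : Finset (ℝ → ℝ)), f x = y j := by
    intro f hf
    rw [Finset.mem_insert, Finset.mem_singleton] at hf
    rcases hf with rfl | rfl
    · rfl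
    · exact hxi
  refine ⟨?_, Finset.card_pair (const_ne_sub_sq _ _), fun f hf g hg =>
    (hval f hf).trans (hval g hg).symm, fun f hf => ?_⟩
  · intro f hf
    change f ∈ ({Φ (.inl j), Φ (.inr i)} : Finset (ℝ → ℝ)) at hf
    rw [Finset.mem_insert, Finset.mem_singleton] at hf
    rcases hf with rfl | rfl <;> exact Finset.mem_image_of_mem _ (Finset.mem_univ _)
  · have hsub : {h ∈ F | h ∉ (P ((j, i), b)).2 ∧ h x < f x} ⊆
        (Finset.univ.erase j).image fun j' => Φ (.inl j') := by
      intro h hh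
      obtain ⟨hF, hne, hlt⟩ := Finset.mem_filter.mp hh
      rw [hval f hf] at hlt
      obtain ⟨j' | i', -, rfl⟩ := Finset.mem_image.mp hF
      · refine Finset.mem_image_of_mem (fun j' => Φ (.inl j'))
          (Finset.mem_erase.mpr ⟨?_, Finset.mem_univ _⟩)
        rintro rfl
        exact hne (Finset.mem_insert_self _ _)
      · obtain rfl : i' = i := Fin.ext <|
          nat_eq_of_sub_sq_lt (x := x) (lt_trans hlt (hy4 j)) (hxi.trans_lt (hy4 j))
        exact absurd (Finset.mem_insert_of_mem (Finset.mem_singleton_self _)) hne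
    have hle := (Finset.card_le_card hsub).trans Finset.card_image_le
    rw [Finset.card_erase_of_mem (Finset.mem_univ _), Finset.card_univ, Fintype.card_fin] at hle
    change (({h ∈ F | h ∉ (P ((j, i), b)).2 ∧ h x < f x}.card : ℕ) : ℤ) ≤ (k : ℤ) - 2
    omega
end
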